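/- Suppose p : [-1,1] → [1,∞) is continuous and for every piecewise linear nonnegative u with u(±1)=0 we have ∫_{-1}^1 |((u^*)'(x)|^{p(x)} dx ≤ ∫_{-1}^1 |u'(x)|^{p(x)} dx, where u^* is the symmetric decreasing rearrangement of u on [-1,1]. Then p is constant. -/

import Mathlib

open Set MeasureTheory

/-- The symmetric decreasing rearrangement on `[-1,1]`:
`u^*(x) = ∫₀^∞ χ_{{u>t}^*}(x) dt`, where `E^* = [-|E|/2, |E|/2]`. -/
noncomputable def symmRearrangement (u : ℝ → ℝ) (x : ℝ) : ℝ :=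
  ∫ t in Ioi (0:ℝ),
    indicator
      (Icc (-(volume {y ∈ Icc (-1:ℝ) 1 | u y > t}).toReal / 2)
           ((volume {y ∈ Icc (-1:ℝ) 1 | u y > t}).toReal / 2))
      (fun _ => (1:ℝ)) x

/-- `u` is continuous and piecewise linear on `[-1,1]`. -/
def IsPiecewiseLinear (u : ℝ → ℝ) : Prop :=
  ContinuousOn u (Icc (-1) 1) ∧
    ∃ (n : ℕ) (a : Fin (n + 1) → ℝ), StrictMono a ∧ a 0 = -1 ∧ a (Fin.last n) = 1 ∧
      ∀ i : Fin n, ∃ c d : ℝ, ∀ x ∈ Icc (a i.castSucc) (a i.succ), u x = c * x + d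

open Filter Topology

noncomputable def tent (c s e : ℝ) (x : ℝ) : ℝ := max 0 (s * (e - |x - c|))

lemma tent_pl (c s e : ℝ) (he : 0 < e) (hs : 0 < s) (h1 : -1 < c - e) (h2 : c + e < 1) :
    IsPiecewiseLinear (tent c s e) := by
  refine ⟨by unfold tent; fun_prop, 4, ![-1, c - e, c, c + e, 1], ?_, ?_, ?_, ?_⟩
  · rw [Fin.strictMono_iff_lt_succ]
    intro i
    fin_cases i
    · simpa using h1
    · simpa using he
    · simpa using he
    · simpa using h2
  · simp
  · rfl
  · intro i
    fin_cases i
    · refine ⟨0, 0, fun x hx => ?_⟩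
      have hx2 : x ≤ c - e := hx.2
      unfold tent
      rw [abs_of_nonpos (by linarith), max_eq_left]
      · ring
      · nlinarith
    · refine ⟨s, s * (e - c), fun x hx => ?_⟩
      have hx1 : c - e ≤ x := hx.1
      have hx2 : x ≤ c := hx.2
      unfold tent
      rw [abs_of_nonpos (by linarith), max_eq_right]
      · ring
      · apply mul_nonneg hs.le; linarith
    · refine ⟨-s, s * (e + c), fun x hx => ?_⟩
      have hx1 : c ≤ x := hx.1
      have hx2 : x ≤ c + e := hx.2
      unfold tent
      rw [abs_of_nonneg (by linarith), max_eq_right]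
      · ring
      · apply mul_nonneg hs.le; linarith
    · refine ⟨0, 0, fun x hx => ?_⟩
      have hx2 : c + e ≤ x := hx.1
      unfold tent
      rw [abs_of_nonneg (by linarith), max_eq_left]
      · ring
      · nlinarith

lemma deriv_tent_in (c s e x : ℝ) (hs : 0 < s) (hx : x ≠ c) (h : |x - c| < e) :
    |deriv (tent c s e) x| = s := by
  have hev : ∀ᶠ y in 𝓝 x, |y - c| < e := by
    have : Continuous fun y : ℝ => |y - c| := by fun_prop
    exact this.continuousAt.eventually (gt_mem_nhds h)
  rcases lt_or_gt_of_ne hx with hlt | hgt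
  · have : tent c s e =ᶠ[𝓝 x] fun y => s * (e - c) + s * y := by
      filter_upwards [hev, gt_mem_nhds hlt] with y hy hy2
      unfold tent
      rw [max_eq_right (mul_nonneg hs.le (by linarith)), abs_of_neg (by linarith)]
      ring
    rw [this.deriv_eq]
    simp [hs.le]
  · have : tent c s e =ᶠ[𝓝 x] fun y => s * (e + c) + (-s) * y := by
      filter_upwards [hev, lt_mem_nhds hgt] with y hy hy2
      unfold tent
      rw [max_eq_right (mul_nonneg hs.le (by linarith)), abs_of_pos (by linarith)]
      ring
    rw [this.deriv_eq]
    simp [hs.le]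

lemma deriv_tent_out (c s e x : ℝ) (hs : 0 < s) (h : e < |x - c|) :
    |deriv (tent c s e) x| = 0 := by
  have hev : ∀ᶠ y in 𝓝 x, e < |y - c| := by
    have : Continuous fun y : ℝ => |y - c| := by fun_prop
    exact this.continuousAt.eventually (lt_mem_nhds h)
  have : tent c s e =ᶠ[𝓝 x] fun y => 0 := by
    filter_upwards [hev] with y hy
    unfold tent
    rw [max_eq_left]
    nlinarith
  rw [this.deriv_eq]
  simp

lemma symm_tent (c s e x : ℝ) (he : 0 < e) (hs : 0 < s) (h1 : -1 < c - e) (h2 : c + e < 1)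
    (hx : x ≠ 0) : symmRearrangement (tent c s e) x = tent 0 s e x := by
  have hset : ∀ t : ℝ, 0 < t → {y ∈ Icc (-1:ℝ) 1 | tent c s e y > t} =
      Ioo (c - (e - t / s)) (c + (e - t / s)) := by
    intro t ht
    have hts : 0 < t / s := div_pos ht hs
    ext y
    have key : tent c s e y > t ↔ |y - c| < e - t / s := by
      unfold tent
      rw [gt_iff_lt, lt_max_iff, or_iff_right (not_lt.2 ht.le), ← div_lt_iff₀' hs]
      constructor <;> intro h <;> linarith
    simp only [mem_ofPred_eq, key, mem_Icc, mem_Ioo, abs_lt]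
    constructor
    · rintro ⟨-, h, h'⟩
      constructor <;> linarith
    · rintro ⟨h, h'⟩
      refine ⟨⟨?_, ?_⟩, ?_, ?_⟩ <;> linarith
  unfold symmRearrangement
  have hx' : 0 < |x| := abs_pos.2 hx
  have : ∀ t ∈ Ioi (0:ℝ), indicator
      (Icc (-(volume {y ∈ Icc (-1:ℝ) 1 | tent c s e y > t}).toReal / 2)
           ((volume {y ∈ Icc (-1:ℝ) 1 | tent c s e y > t}).toReal / 2))
      (fun _ => (1:ℝ)) x = indicator (Ioc 0 (s * (e - |x|))) (fun _ => (1:ℝ)) t := by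
    intro t ht
    rw [hset t ht, Real.volume_Ioo]
    have ht' : 0 < t := ht
    have hk : t ≤ s * (e - |x|) ↔ |x| ≤ e - t / s := by
      rw [← div_le_iff₀' hs]
      constructor <;> intro h <;> linarith
    have : (x ∈ Icc (-(ENNReal.ofReal (c + (e - t / s) - (c - (e - t / s)))).toReal / 2)
        ((ENNReal.ofReal (c + (e - t / s) - (c - (e - t / s)))).toReal / 2)) ↔
        t ∈ Ioc 0 (s * (e - |x|)) := by
      rw [ENNReal.toReal_ofReal', neg_div, mem_Icc, ← abs_le, mem_Ioc, and_iff_right ht', hk]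
      rcases le_total (c + (e - t / s) - (c - (e - t / s))) 0 with h | h
      · rw [max_eq_right h]
        constructor <;> intro h' <;> linarith
      · rw [max_eq_left h]
        constructor <;> intro h' <;> linarith
    simp only [indicator, this]
  rw [setIntegral_congr_fun measurableSet_Ioi this, setIntegral_indicator measurableSet_Ioc,
    inter_eq_right.2 (fun t (ht : t ∈ Ioc 0 (s * (e - |x|))) => show t ∈ Ioi (0:ℝ) from ht.1)]
  simp [tent, measureReal_def, ENNReal.toReal_ofReal', max_comm]

lemma energy (p : ℝ → ℝ) (hp1 : ∀ x ∈ Icc (-1:ℝ) 1, 1 ≤ p x) (f : ℝ → ℝ)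
    (c s e : ℝ) (hs : 0 < s) (h1 : -1 < c - e) (h2 : c + e < 1)
    (hf : ∀ x, x ≠ c → deriv f x = deriv (tent c s e) x) :
    ∫ x in (-1:ℝ)..1, |deriv f x| ^ p x = ∫ x in Ioo (c - e) (c + e), s ^ p x := by
  rw [intervalIntegral.integral_of_le (by norm_num)]
  have hae : ∀ᵐ x ∂(volume : Measure ℝ), x ∈ Ioc (-1:ℝ) 1 → |deriv f x| ^ p x =
      indicator (Ioo (c - e) (c + e)) (fun x => s ^ p x) x := by
    filter_upwards [Measure.ae_ne volume c, Measure.ae_ne volume (c - e),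
      Measure.ae_ne volume (c + e)] with x hxc hx1 hx2 hx
    rw [hf x hxc]
    by_cases hm : x ∈ Ioo (c - e) (c + e)
    · rw [indicator_of_mem hm, deriv_tent_in c s e x hs hxc]
      rw [abs_lt]; constructor <;> linarith [hm.1, hm.2]
    · rw [indicator_of_notMem hm, deriv_tent_out c s e x hs, Real.zero_rpow]
      · linarith [hp1 x ⟨hx.1.le, hx.2⟩]
      · by_contra hcon
        rw [not_lt, abs_le] at hcon
        apply hm
        constructor
        · exact lt_of_le_of_ne (by linarith) (Ne.symm hx1)
        · exact lt_of_le_of_ne (by linarith) hx2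
  rw [setIntegral_congr_ae measurableSet_Ioc hae, setIntegral_indicator measurableSet_Ioo,
    inter_eq_right.2 (fun t (ht : t ∈ Ioo (c - e) (c + e)) => show t ∈ Ioc (-1:ℝ) 1 from ⟨by linarith [ht.1], (by linarith [ht.2])⟩)]

lemma core (p : ℝ → ℝ) (hp : ContinuousOn p (Icc (-1) 1))
    (hp1 : ∀ x ∈ Icc (-1:ℝ) 1, 1 ≤ p x)
    (H : ∀ u : ℝ → ℝ, IsPiecewiseLinear u → (∀ x ∈ Icc (-1:ℝ) 1, 0 ≤ u x) →
      u (-1) = 0 → u 1 = 0 →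
      ∫ x in (-1:ℝ)..1, |deriv (symmRearrangement u) x| ^ p x ≤
        ∫ x in (-1:ℝ)..1, |deriv u x| ^ p x)
    (s : ℝ) (hs : 0 < s) (c : ℝ) (hc : c ∈ Ioo (-1:ℝ) 1) : s ^ p 0 ≤ s ^ p c := by
  by_contra! hlt
  obtain ⟨a, ha1, ha2⟩ := exists_between hlt
  obtain ⟨b, hb1, hb2⟩ := exists_between ha2
  have hq : ContinuousOn (fun x => s ^ p x) (Icc (-1) 1) :=
    ContinuousOn.rpow continuousOn_const hp (fun x _ => Or.inl hs.ne')
  have hc0 : ContinuousAt (fun x => s ^ p x) 0 :=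
    hq.continuousAt (Icc_mem_nhds (by norm_num) (by norm_num))
  have hcc : ContinuousAt (fun x => s ^ p x) c := hq.continuousAt (Icc_mem_nhds hc.1 hc.2)
  obtain ⟨e1, he1, h1⟩ := Metric.eventually_nhds_iff.1 (hc0.eventually (lt_mem_nhds hb2))
  obtain ⟨e2, he2, h2⟩ := Metric.eventually_nhds_iff.1 (hcc.eventually (gt_mem_nhds ha1))
  obtain ⟨e, he, hee⟩ : ∃ e > 0, e < e1 ∧ e < e2 ∧ e < 1 ∧ e < 1 - c ∧ e < c + 1 := by
    have : 0 < min e1 (min e2 (min 1 (min (1 - c) (c + 1)))) := by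
      have := hc.1; have := hc.2
      simp only [lt_min_iff]
      refine ⟨he1, he2, one_pos, ?_, ?_⟩ <;> linarith
    obtain ⟨e, h, h'⟩ := exists_between this
    simp only [lt_min_iff] at h'
    exact ⟨e, h, h'⟩
  obtain ⟨hee1, hee2, hee3, hee4, hee5⟩ := hee
  have hz : ∀ x, e ≤ |x - c| → tent c s e x = 0 := by
    intro x hx
    unfold tent
    rw [max_eq_left]
    nlinarith
  have hH := H (tent c s e) (tent_pl c s e he hs (by linarith) (by linarith))
    (fun x _ => le_max_left _ _)
    (hz _ (by rw [abs_of_neg (by linarith [hc.1])]; linarith))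
    (hz _ (by rw [abs_of_pos (by linarith [hc.2])]; linarith))
  rw [energy p hp1 _ 0 s e hs (by linarith) (by linarith), energy p hp1 _ c s e hs
    (by linarith) (by linarith) (fun _ _ => rfl)] at hH
  swap
  · intro x hx
    apply EventuallyEq.deriv_eq
    filter_upwards [isOpen_ne.mem_nhds hx] with y hy
    exact symm_tent c s e y he hs (by linarith) (by linarith) hy
  have hint : ∀ d, -1 ≤ d - e → d + e ≤ 1 →
      IntegrableOn (fun x => s ^ p x) (Ioo (d - e) (d + e)) := fun d h h' =>
    hq.integrableOn_Icc.mono_set (fun x hx => ⟨by linarith [hx.1], by linarith [hx.2]⟩)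
  have hcst : ∀ d m : ℝ, ∫ x in Ioo (d - e) (d + e), m = 2 * e * m := by
    intro d m
    have : d + e - (d - e) = 2 * e := by ring
    rw [setIntegral_const, measureReal_def, Real.volume_Ioo, this,
      ENNReal.toReal_ofReal (by linarith), smul_eq_mul]
  have hL : 2 * e * b ≤ ∫ x in Ioo (0 - e) (0 + e), s ^ p x := by
    rw [← hcst 0 b]
    refine setIntegral_mono_on (by simp) (hint 0 (by linarith) (by linarith))
      measurableSet_Ioo (fun x hx => ?_)
    refine (h1 ?_).le
    rw [Real.dist_eq, abs_lt]; constructor <;> linarith [hx.1, hx.2]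
  have hR : ∫ x in Ioo (c - e) (c + e), s ^ p x ≤ 2 * e * a := by
    rw [← hcst c a]
    refine setIntegral_mono_on (hint c (by linarith) (by linarith)) (by simp)
      measurableSet_Ioo (fun x hx => ?_)
    refine (h2 ?_).le
    rw [Real.dist_eq, abs_lt]; constructor <;> linarith [hx.1, hx.2]
  nlinarith

theorem stmt_8 (p : ℝ → ℝ) (hp : ContinuousOn p (Icc (-1) 1))
    (hp1 : ∀ x ∈ Icc (-1:ℝ) 1, 1 ≤ p x)
    (H : ∀ u : ℝ → ℝ, IsPiecewiseLinear u → (∀ x ∈ Icc (-1:ℝ) 1, 0 ≤ u x) →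
      u (-1) = 0 → u 1 = 0 →
      ∫ x in (-1:ℝ)..1, |deriv (symmRearrangement u) x| ^ p x ≤
        ∫ x in (-1:ℝ)..1, |deriv u x| ^ p x) :
    ∀ x ∈ Icc (-1:ℝ) 1, ∀ y ∈ Icc (-1:ℝ) 1, p x = p y := by
  have hI : EqOn p (fun _ => p 0) (Ioo (-1) 1) := by
    intro c hc
    have h2 := core p hp hp1 H 2 (by norm_num) c hc
    have h3 := core p hp hp1 H (1/2) (by norm_num) c hc
    rw [Real.rpow_le_rpow_left_iff (by norm_num)] at h2
    rw [Real.rpow_le_rpow_left_iff_of_base_lt_one (by norm_num) (by norm_num)] at h3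
    exact le_antisymm h3 h2
  have hA : EqOn p (fun _ => p 0) (Icc (-1) 1) :=
    hI.of_subset_closure hp continuousOn_const Ioo_subset_Icc_self
      (by rw [closure_Ioo (by norm_num)])
  intro x hx y hy
  exact (hA hx).trans (hA hy).symm
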